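/- arXiv:1301.1082 — 3 statements merged into one kernel-verified Lean document; each statement's English description precedes it below -/
import Mathlib

section
/- Let E = ℝⁿ with its Euclidean inner product, let f : ℝ → E → E be continuously differentiable jointly in (t, x), and let φ : ℝ → E → E satisfy: φ(s₀, x) = x for all x; for all t and x the curve τ ↦ φ(τ, x) has derivative f(t, φ(t, x)) at τ = t; and φ is continuously differentiable jointly in (t, x). Fix x₀, v₀ ∈ E and set v(t) := D_x φ(t, ·)(x₀) v₀, the spatial derivative of the flow applied to v₀. Then v(s₀) = v₀ and v satisfies the variational (tangent lift) equation: for every t, v'(t) = D_x f(t, φ(t, x₀)) v(t). -/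
/-- Exchange of partial derivatives: if `F` has time derivative `G`, and `G` has an `s`-derivative
`B`, with `G` and `B` jointly continuous, then the `s`-derivative of `F` at `s = 0` is
differentiable in time with derivative `B · 0`. -/
theorem hasDerivAt_partial_swap {E : Type*} [NormedAddCommGroup E] [NormedSpace ℝ E]
    [CompleteSpace E] {F G B : ℝ → ℝ → E} {A : ℝ → E}
    (hF : ∀ t s, HasDerivAt (fun τ => F τ s) (G t s) t)
    (hA : ∀ t, HasDerivAt (F t) (A t) 0)
    (hG : ∀ t s, HasDerivAt (G t) (B t s) s)
    (hGc : Continuous (Function.uncurry G)) (hBc : Continuous (Function.uncurry B)) (t : ℝ) :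
    HasDerivAt A (B t 0) t := by
  have hGt : ∀ s, Continuous fun τ => G τ s := fun s => hGc.comp (.prodMk_left s)
  have hBt : Continuous fun τ => B τ 0 := hBc.comp (.prodMk_left 0)
  have hint : ∀ τ, A τ = A t + ∫ r in t..τ, B r 0 := by
    intro τ
    obtain ⟨C, hC⟩ := ((isCompact_uIcc (a := t) (b := τ)).prod
      (isCompact_closedBall (0 : ℝ) 1)).exists_bound_of_continuousOn hBc.continuousOn
    have hderiv := (intervalIntegral.hasDerivAt_integral_of_dominated_loc_of_deriv_le
      (μ := MeasureTheory.volume) (F := fun s r => G r s) (F' := fun s r => B r s) (x₀ := 0)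
      (a := t) (b := τ) (bound := fun _ => C)
      (Metric.closedBall_mem_nhds 0 one_pos)
      (.of_forall fun s => (hGt s).aestronglyMeasurable)
      ((hGt 0).intervalIntegrable _ _) hBt.aestronglyMeasurable
      (.of_forall fun r hr s hs => hC (r, s) ⟨Set.uIoc_subset_uIcc hr, hs⟩)
      intervalIntegrable_const (.of_forall fun r _ s _ => hG r s)).2
    have hFτ : F τ = fun s => F t s + ∫ r in t..τ, G r s := by
      funext s
      rw [intervalIntegral.integral_eq_sub_of_hasDerivAt (fun r _ => hF r s)
        ((hGt s).intervalIntegrable _ _)]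
      abel
    have hsum := (hA t).add hderiv
    exact (hA τ).unique (hFτ ▸ hsum)
  rw [funext hint]
  exact (hBt.integral_hasStrictDerivAt t t).hasDerivAt.const_add _

/-- The derivative in the second variable of a jointly `C¹` map, applied to a vector, is jointly
continuous. -/
theorem continuous_fderiv_snd_apply {E F : Type*} [NormedAddCommGroup E] [NormedSpace ℝ E]
    [NormedAddCommGroup F] [NormedSpace ℝ F] {f : ℝ → E → F}
    (hf : ContDiff ℝ 1 (Function.uncurry f)) :
    Continuous fun p : (ℝ × E) × E => fderiv ℝ (f p.1.1) p.1.2 p.2 := by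
  have heq : ∀ t x v, fderiv ℝ (f t) x v = fderiv ℝ (Function.uncurry f) (t, x) (0, v) := by
    intro t x v
    have h := ((hf.differentiable one_ne_zero) (t, x)).hasFDerivAt.comp x
      (hasFDerivAt_prodMk_right t x)
    exact congrArg (· v) h.fderiv
  simp_rw [heq]
  exact ((hf.continuous_fderiv one_ne_zero).comp continuous_fst).clm_apply
    (continuous_const.prodMk continuous_snd)

/-- The push-forward of an initial tangent vector `v₀` by the flow of a time-dependent
vector field `f` solves the variational (tangent lift) equation `v' = D_x f · v` with
initial condition `v (s₀) = v₀`. -/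
theorem flow_derivative_solves_variational_equation
    (n : ℕ) (f φ : ℝ → EuclideanSpace ℝ (Fin n) → EuclideanSpace ℝ (Fin n)) (s₀ : ℝ)
    (hf : ContDiff ℝ 1 (Function.uncurry f))
    (hφ0 : ∀ x, φ s₀ x = x)
    (hφ' : ∀ t x, HasDerivAt (fun τ => φ τ x) (f t (φ t x)) t)
    (hφ : ContDiff ℝ 1 (Function.uncurry φ))
    (x₀ v₀ : EuclideanSpace ℝ (Fin n)) :
    fderiv ℝ (φ s₀) x₀ v₀ = v₀ ∧
      ∀ t, HasDerivAt (fun τ => fderiv ℝ (φ τ) x₀ v₀)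
        (fderiv ℝ (f t) (φ t x₀) (fderiv ℝ (φ t) x₀ v₀)) t := by
  refine ⟨?_, fun t => ?_⟩
  · rw [show φ s₀ = id from funext hφ0, fderiv_id]
    rfl
  have hfd : ∀ t x, DifferentiableAt ℝ (f t) x := fun t x =>
    ((hf.comp (contDiff_prodMk_right t)).differentiable one_ne_zero) x
  have hφd : ∀ t x, DifferentiableAt ℝ (φ t) x := fun t x =>
    ((hφ.comp (contDiff_prodMk_right t)).differentiable one_ne_zero) x
  have hline : ∀ s : ℝ, HasDerivAt (fun s : ℝ => x₀ + s • v₀) v₀ s := fun s => by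
    simpa using ((hasDerivAt_id s).smul_const v₀).const_add x₀
  have hφs : ∀ t s, HasDerivAt (fun s : ℝ => φ t (x₀ + s • v₀))
      (fderiv ℝ (φ t) (x₀ + s • v₀) v₀) s := fun t s =>
    (hφd t _).hasFDerivAt.comp_hasDerivAt s (hline s)
  have hpt : Continuous fun p : ℝ × ℝ => (p.1, x₀ + p.2 • v₀) := by fun_prop
  have hflow : Continuous fun p : ℝ × ℝ => (p.1, φ p.1 (x₀ + p.2 • v₀)) :=
    continuous_fst.prodMk (hφ.continuous.comp hpt)
  have key := hasDerivAt_partial_swap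
    (F := fun t s => φ t (x₀ + s • v₀)) (G := fun t s => f t (φ t (x₀ + s • v₀)))
    (B := fun t s => fderiv ℝ (f t) (φ t (x₀ + s • v₀)) (fderiv ℝ (φ t) (x₀ + s • v₀) v₀))
    (fun t s => hφ' t _) (fun t => hφs t 0)
    (fun t s => (hfd t _).hasFDerivAt.comp_hasDerivAt s (hφs t s))
    (hf.continuous.comp hflow)
    ((continuous_fderiv_snd_apply hf).comp (hflow.prodMk
      ((continuous_fderiv_snd_apply hφ).comp (hpt.prodMk continuous_const)))) t
  simpa using key
end

section
/- Let E = ℝⁿ with its Euclidean inner product, let f : ℝ → E → E be continuously differentiable jointly in (t, x), and let φ : ℝ → E → E satisfy: φ(s₀, x) = x for all x; for all t and x the curve τ ↦ φ(τ, x) has derivative f(t, φ(t, x)) at τ = t; and φ is continuously differentiable jointly in (t, x). Fix x₀, p₀ ∈ E and suppose p : ℝ → E satisfies the adjoint (cotangent lift) equation p'(t) = −(D_x f(t, φ(t, x₀)))* p(t) for all t, with p(s₀) = p₀. Then for every t, (D_x φ(t, ·)(x₀))* p(t) = p₀; that is, p(t) is obtained from p₀ by the inverse of the adjoint (pullback)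 of the spatial derivative of the flow. -/
open Set

section

variable {E F : Type*} [NormedAddCommGroup E] [NormedSpace ℝ E]
  [NormedAddCommGroup F] [NormedSpace ℝ F]

/-- The partial derivative in the second variable of a jointly `C¹` map is jointly continuous. -/
lemma continuous_fderiv_snd_of_contDiff {g : ℝ → E → F}
    (hg : ContDiff ℝ 1 (Function.uncurry g)) :
    Continuous fun q : ℝ × E => fderiv ℝ (g q.1) q.2 := by
  have h : ContDiff ℝ 1 (Function.uncurry fun (q : ℝ × E) (y : E) => g q.1 y) :=
    hg.comp (contDiff_fst.fst.prodMk contDiff_snd)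
  exact (ContDiff.fderiv (n := 0) h contDiff_snd (by norm_num)).continuous

lemma differentiable_of_contDiff_uncurry {g : ℝ → E → F}
    (hg : ContDiff ℝ 1 (Function.uncurry g)) (t : ℝ) : Differentiable ℝ (g t) :=
  (hg.comp (contDiff_const.prodMk contDiff_id)).differentiable (by norm_num)

/-- Differentiation under the integral sign for a jointly `C¹` integrand. -/
lemma hasFDerivAt_intervalIntegral_of_contDiff [ProperSpace E] {g : ℝ → E → F}
    (hg : ContDiff ℝ 1 (Function.uncurry g)) (a b : ℝ) (x₀ : E) :
    HasFDerivAt (fun x => ∫ s in a..b, g s x) (∫ s in a..b, fderiv ℝ (g s) x₀) x₀ := by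
  have hD := continuous_fderiv_snd_of_contDiff hg
  have hcont (x : E) : Continuous fun s => g s x :=
    hg.continuous.comp (continuous_id.prodMk continuous_const)
  have hDcont : Continuous fun s => fderiv ℝ (g s) x₀ :=
    hD.comp (continuous_id.prodMk continuous_const)
  obtain ⟨C, hC⟩ := (isCompact_uIcc.prod
    (isCompact_closedBall x₀ 1)).exists_bound_of_continuousOn (s := uIcc a b ×ˢ _) hD.continuousOn
  refine intervalIntegral.hasFDerivAt_integral_of_dominated_of_fderiv_le
    (F := fun x s => g s x) (F' := fun x s => fderiv ℝ (g s) x) (bound := fun _ => C)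
    (Metric.closedBall_mem_nhds x₀ one_pos)
    (.of_forall fun x => (hcont x).aestronglyMeasurable)
    ((hcont x₀).intervalIntegrable a b) hDcont.aestronglyMeasurable
    (.of_forall fun s hs x hx => hC (s, x) ⟨uIoc_subset_uIcc hs, hx⟩)
    intervalIntegrable_const
    (.of_forall fun s _ x _ => (differentiable_of_contDiff_uncurry hg s x).hasFDerivAt)

/-- The spatial derivative of a flow solves the variational equation. -/
lemma hasDerivAt_fderiv_flow [ProperSpace E] {f φ : ℝ → E → E} {s₀ : ℝ}
    (hf : ContDiff ℝ 1 (Function.uncurry f))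
    (hφ0 : ∀ x, φ s₀ x = x)
    (hφ' : ∀ t x, HasDerivAt (fun τ => φ τ x) (f t (φ t x)) t)
    (hφ : ContDiff ℝ 1 (Function.uncurry φ)) (x₀ : E) (t : ℝ) :
    HasDerivAt (fun τ => fderiv ℝ (φ τ) x₀)
      (fderiv ℝ (f t) (φ t x₀) ∘L fderiv ℝ (φ t) x₀) t := by
  have hg : ContDiff ℝ 1 (Function.uncurry fun s x => f s (φ s x)) :=
    hf.comp (contDiff_fst.prodMk hφ)
  have hint (τ : ℝ) : φ τ = fun x => x + ∫ s in s₀..τ, f s (φ s x) := by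
    funext x
    have hc : Continuous fun s => f s (φ s x) :=
      hg.continuous.comp (continuous_id.prodMk continuous_const)
    rw [intervalIntegral.integral_eq_sub_of_hasDerivAt (fun s _ => hφ' s x)
      (hc.intervalIntegrable _ _), hφ0]
    abel
  have hfd : (fun τ => fderiv ℝ (φ τ) x₀) = fun τ => ContinuousLinearMap.id ℝ E +
      ∫ s in s₀..τ, fderiv ℝ (fun x => f s (φ s x)) x₀ := by
    funext τ
    conv_lhs => rw [hint τ]
    exact ((hasFDerivAt_id x₀).add
      (hasFDerivAt_intervalIntegral_of_contDiff hg s₀ τ x₀)).fderiv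
  have hDc : Continuous fun s => fderiv ℝ (fun x => f s (φ s x)) x₀ :=
    (continuous_fderiv_snd_of_contDiff hg).comp (continuous_id.prodMk continuous_const)
  have hchain : fderiv ℝ (fun x => f t (φ t x)) x₀ =
      fderiv ℝ (f t) (φ t x₀) ∘L fderiv ℝ (φ t) x₀ :=
    fderiv_comp x₀ (differentiable_of_contDiff_uncurry hf t _)
      (differentiable_of_contDiff_uncurry hφ t _)
  rw [hfd, ← hchain]
  exact (intervalIntegral.integral_hasDerivAt_right (hDc.intervalIntegrable _ _)
    (hDc.stronglyMeasurableAtFilter _ _) hDc.continuousAt).const_add _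

end

/-- The flow of the cotangent lift: if `p` solves the adjoint equation
`p' = −(D_x f(t, φ(t, x₀)))* p` with `p s₀ = p₀`, then `p t` is the image of `p₀`
under the inverse adjoint (pullback) of the spatial derivative of the flow, i.e.
`(D_x φ(t,·)(x₀))* (p t) = p₀` for all `t`. -/
theorem adjoint_equation_solution_is_inverse_pullback_of_flow
    (n : ℕ) (f φ : ℝ → EuclideanSpace ℝ (Fin n) → EuclideanSpace ℝ (Fin n)) (s₀ : ℝ)
    (hf : ContDiff ℝ 1 (Function.uncurry f))
    (hφ0 : ∀ x, φ s₀ x = x)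
    (hφ' : ∀ t x, HasDerivAt (fun τ => φ τ x) (f t (φ t x)) t)
    (hφ : ContDiff ℝ 1 (Function.uncurry φ))
    (x₀ p₀ : EuclideanSpace ℝ (Fin n))
    (p : ℝ → EuclideanSpace ℝ (Fin n))
    (hp : ∀ t, HasDerivAt p
      (-(ContinuousLinearMap.adjoint (fderiv ℝ (f t) (φ t x₀)) (p t))) t)
    (hp0 : p s₀ = p₀) :
    ∀ t, ContinuousLinearMap.adjoint (fderiv ℝ (φ t) x₀) (p t) = p₀ := by
  intro t
  refine ext_inner_right ℝ fun v => ?_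
  rw [ContinuousLinearMap.adjoint_inner_left]
  have hderiv (τ : ℝ) : HasDerivAt (fun τ => inner ℝ (p τ) (fderiv ℝ (φ τ) x₀ v)) 0 τ := by
    have hv := (hasDerivAt_fderiv_flow hf hφ0 hφ' hφ x₀ τ).clm_apply (hasDerivAt_const τ v)
    refine ((hp τ).inner ℝ hv).congr_deriv ?_
    simp [inner_neg_left, ContinuousLinearMap.adjoint_inner_left]
  have hconst := is_const_of_deriv_eq_zero (fun τ => (hderiv τ).differentiableAt)
    (fun τ => (hderiv τ).deriv) t s₀
  have hφs₀ : φ s₀ = id := funext hφ0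
  simpa [hφs₀, hp0] using hconst
end

section
/- Let E = ℝⁿ with its Euclidean inner product, let f : ℝ → E → E be continuously differentiable jointly in (t, x), and let φ : ℝ → E → E satisfy: φ(s₀, x) = x for all x; for all t and x the curve τ ↦ φ(τ, x) has derivative f(t, φ(t, x)) at τ = t; and φ is continuously differentiable jointly in (t, x). Fix x₀, v₀ ∈ E. If w : ℝ → E is any solution of the variational equation w'(t) = D_x f(t, φ(t, x₀)) w(t) for all t with w(s₀) = v₀, then w(t) = D_x φ(t, ·)(x₀) v₀ for all t; i.e., the solution of the tangent-lift equation with initial tangent vector v₀ is exactly the push-forward of v₀ by the flow. -/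
open Set MeasureTheory Topology

section VariationalEquation

variable {E F : Type*} [NormedAddCommGroup E] [NormedSpace ℝ E]
  [NormedAddCommGroup F] [NormedSpace ℝ F]

/-- The partial derivative in the second variable of a jointly `C¹` map is jointly continuous. -/
theorem ContDiff.continuous_fderiv_snd {f : ℝ → E → F}
    (hf : ContDiff ℝ 1 (Function.uncurry f)) :
    Continuous fun p : ℝ × E => fderiv ℝ (f p.1) p.2 := by
  have h : ContDiff ℝ 1 (Function.uncurry fun (p : ℝ × E) (x : E) => f p.1 x) :=
    hf.comp ((contDiff_fst.comp contDiff_fst).prodMk contDiff_snd)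
  exact (h.fderiv (contDiff_snd (n := 0)) (by norm_num)).continuous

/-- The slices of a jointly `C¹` map are differentiable. -/
theorem ContDiff.differentiable_snd {f : ℝ → E → F}
    (hf : ContDiff ℝ 1 (Function.uncurry f)) (t : ℝ) : Differentiable ℝ (f t) :=
  (hf.comp (contDiff_const.prodMk contDiff_id)).differentiable one_ne_zero

/-- Differentiation under an interval integral when the partial derivative in the parameter
exists everywhere and is jointly continuous. -/
theorem intervalIntegral.hasDerivAt_integral_of_continuous_deriv {F₀ F₁ : ℝ → ℝ → E}
    (hF : ∀ s, Continuous (F₀ s)) (hF₁ : Continuous (Function.uncurry F₁))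
    (hderiv : ∀ s t, HasDerivAt (fun r => F₀ r t) (F₁ s t) s) (s a b : ℝ) :
    HasDerivAt (fun r => ∫ t in a..b, F₀ r t) (∫ t in a..b, F₁ s t) s := by
  obtain ⟨C, hC⟩ := ((isCompact_closedBall s 1).prod (isCompact_uIcc (a := a) (b := b))
    ).exists_bound_of_continuousOn hF₁.continuousOn
  have hs : Continuous (F₁ s) := hF₁.comp (continuous_const.prodMk continuous_id)
  exact (intervalIntegral.hasDerivAt_integral_of_dominated_loc_of_deriv_le (bound := fun _ => C)
    (Metric.closedBall_mem_nhds s one_pos)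
    (.of_forall fun r => (hF r).aestronglyMeasurable)
    ((hF s).intervalIntegrable a b) hs.aestronglyMeasurable
    (.of_forall fun t ht r hr => hC (r, t) ⟨hr, uIoc_subset_uIcc ht⟩)
    intervalIntegrable_const
    (.of_forall fun t _ r _ => hderiv r t)).2

/-- Solutions of a linear equation `w' = A(t) w` with continuous coefficients are determined by
their value at one time. -/
theorem linear_ODE_solution_unique {A : ℝ → E →L[ℝ] E} (hA : Continuous A) {w z : ℝ → E} {s₀ : ℝ}
    (hw : ∀ t, HasDerivAt w (A t (w t)) t) (hz : ∀ t, HasDerivAt z (A t (z t)) t)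
    (h₀ : w s₀ = z s₀) : w = z := by
  ext t
  obtain ⟨a, b, ht, hs₀⟩ : ∃ a b, t ∈ Ioo a b ∧ s₀ ∈ Ioo a b :=
    ⟨min t s₀ - 1, max t s₀ + 1, by grind, by grind⟩
  obtain ⟨C, hC⟩ := (isCompact_Icc (a := a) (b := b)).exists_bound_of_continuousOn hA.continuousOn
  refine ODE_solution_unique_of_mem_Ioo (v := fun t x => A t x) (s := fun _ => univ)
    (K := C.toNNReal) (fun r hr => ?_) hs₀ (fun r _ => ⟨hw r, mem_univ _⟩)
    (fun r _ => ⟨hz r, mem_univ _⟩) h₀ ht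
  refine ((A r).lipschitz.weaken ?_).lipschitzOnWith
  exact NNReal.le_toNNReal_of_coe_le (hC r (Ioo_subset_Icc_self hr))

/-- The push-forward of a tangent vector by a `C¹` flow solves the variational equation. -/
theorem hasDerivAt_fderiv_flow_apply [CompleteSpace E] {f φ : ℝ → E → E}
    (hf : ContDiff ℝ 1 (Function.uncurry f))
    (hφ' : ∀ t x, HasDerivAt (fun τ => φ τ x) (f t (φ t x)) t)
    (hφ : ContDiff ℝ 1 (Function.uncurry φ)) (x v : E) (t : ℝ) :
    HasDerivAt (fun τ => fderiv ℝ (φ τ) x v)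
      (fderiv ℝ (f t) (φ t x) (fderiv ℝ (φ t) x v)) t := by
  let γ : ℝ → E := fun s => x + s • v
  have hγ : Continuous γ := by fun_prop
  have hγ' (s : ℝ) : HasDerivAt γ v s := by
    simpa only [one_smul, id_eq] using ((hasDerivAt_id s).smul_const v).const_add x
  have hγ0 : γ 0 = x := by simp [γ]
  have hφγ (τ s : ℝ) : HasDerivAt (fun r => φ τ (γ r)) (fderiv ℝ (φ τ) (γ s) v) s :=
    (hφ.differentiable_snd τ (γ s)).hasFDerivAt.comp_hasDerivAt s (hγ' s)
  let G : ℝ → ℝ → E := fun s τ => fderiv ℝ (f τ) (φ τ (γ s)) (fderiv ℝ (φ τ) (γ s) v)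
  have hφc : Continuous fun p : ℝ × ℝ => φ p.2 (γ p.1) :=
    hφ.continuous.comp (continuous_snd.prodMk (hγ.comp continuous_fst))
  have hG : Continuous (Function.uncurry G) :=
    (hf.continuous_fderiv_snd.comp (continuous_snd.prodMk hφc)).clm_apply
      ((hφ.continuous_fderiv_snd.comp
        (continuous_snd.prodMk (hγ.comp continuous_fst))).clm_apply continuous_const)
  have hfc (s : ℝ) : Continuous fun τ => f τ (φ τ (γ s)) :=
    hf.continuous.comp (continuous_id.prodMk (hφc.comp (continuous_const.prodMk continuous_id)))
  have hG0 : Continuous (G 0) := hG.comp (continuous_const.prodMk continuous_id)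
  have hint (τ : ℝ) : fderiv ℝ (φ τ) x v = fderiv ℝ (φ t) x v + ∫ r in t..τ, G 0 r := by
    have h₁ : HasDerivAt (fun s => ∫ r in t..τ, f r (φ r (γ s))) (∫ r in t..τ, G 0 r) 0 :=
      intervalIntegral.hasDerivAt_integral_of_continuous_deriv hfc hG
        (fun s r => (hf.differentiable_snd r _).hasFDerivAt.comp_hasDerivAt s (hφγ r s)) 0 t τ
    have h₂ : (fun s => φ τ (γ s)) = fun s => φ t (γ s) + ∫ r in t..τ, f r (φ r (γ s)) := by
      ext1 s
      rw [intervalIntegral.integral_eq_sub_of_hasDerivAt (fun r _ => hφ' r (γ s))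
        ((hfc s).intervalIntegrable t τ)]
      abel
    have h₃ := hφγ τ 0
    rw [h₂] at h₃
    simpa only [hγ0] using h₃.unique ((hφγ t 0).add h₁)
  have hz : HasDerivAt (fun τ => fderiv ℝ (φ t) x v + ∫ r in t..τ, G 0 r) (G 0 t) t :=
    (hG0.integral_hasStrictDerivAt t t).hasDerivAt.const_add _
  rw [← funext hint] at hz
  simpa only [G, hγ0] using hz

end VariationalEquation

/-- Uniqueness for the variational equation: any solution `w` of the tangent-lift
equation `w' = D_x f(t, φ(t, x₀)) w` with `w s₀ = v₀` equals the push-forward of `v₀`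
by the spatial derivative of the flow `φ`. -/
theorem variational_equation_solution_eq_flow_pushforward
    (n : ℕ) (f φ : ℝ → EuclideanSpace ℝ (Fin n) → EuclideanSpace ℝ (Fin n)) (s₀ : ℝ)
    (hf : ContDiff ℝ 1 (Function.uncurry f))
    (hφ0 : ∀ x, φ s₀ x = x)
    (hφ' : ∀ t x, HasDerivAt (fun τ => φ τ x) (f t (φ t x)) t)
    (hφ : ContDiff ℝ 1 (Function.uncurry φ))
    (x₀ v₀ : EuclideanSpace ℝ (Fin n))
    (w : ℝ → EuclideanSpace ℝ (Fin n))
    (hw : ∀ t, HasDerivAt w (fderiv ℝ (f t) (φ t x₀) (w t)) t)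
    (hw0 : w s₀ = v₀) :
    ∀ t, w t = fderiv ℝ (φ t) x₀ v₀ := by
  have hcurve : Continuous fun t => φ t x₀ :=
    hφ.continuous.comp (continuous_id.prodMk continuous_const)
  have hA : Continuous fun t => fderiv ℝ (f t) (φ t x₀) :=
    hf.continuous_fderiv_snd.comp (continuous_id.prodMk hcurve)
  have h₀ : w s₀ = fderiv ℝ (φ s₀) x₀ v₀ := by
    rw [show φ s₀ = id from funext hφ0, fderiv_id, hw0, ContinuousLinearMap.id_apply]
  exact congrFun (linear_ODE_solution_unique hA hw (hasDerivAt_fderiv_flow_apply hf hφ' hφ x₀ v₀) h₀)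
end
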